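/- arXiv:math/0401257 — 5 statements merged into one kernel-verified Lean document; each statement's English description precedes it below -/
import Mathlib

section
/- Let ξ(x,y) = (y, 1) and ζ(x,y) = (1, 0) be vector fields on ℝ², and for a, b ∈ ℝ let ξ' = a·ξ + b·ζ, i.e. ξ'(x,y) = (a·y + b, a). Then ∇_{ξ'} ξ' = a²·ζ, and the standard area form evaluates as ω(∇_{ξ'}ξ', ξ')(p) = a³ for every p ∈ ℝ², where ω(v, w) = v₁w₂ − v₂w₁. In particular the normalization conditions ∇_{ξ'}ξ' parallel and ω(∇_{ξ'}ξ', ξ') = 1 force a = 1 and ∇_{ξ'}ξ' = ζ. -/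
/-- The vector field `ξ' = a·ξ + b·ζ`, i.e. `ξ'(x,y) = (a·y + b, a)`, where
`ξ(x,y) = (y, 1)` and `ζ(x,y) = (1, 0)`. -/
noncomputable def xiVF' (a b : ℝ) (p : ℝ × ℝ) : ℝ × ℝ := (a * p.2 + b, a)

/-- The standard area form `ω(v,w) = v₁w₂ − v₂w₁` on `ℝ²`. -/
noncomputable def areaForm (v w : ℝ × ℝ) : ℝ := v.1 * w.2 - v.2 * w.1

theorem hasFDerivAt_xiVF' (a b : ℝ) (p : ℝ × ℝ) :
    HasFDerivAt (xiVF' a b) ((a • ContinuousLinearMap.snd ℝ ℝ ℝ).prod 0) p :=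
  ((hasFDerivAt_snd.const_mul a).add_const b).prodMk (hasFDerivAt_const a p)

theorem fderiv_xiVF'_self (a b : ℝ) (p : ℝ × ℝ) :
    fderiv ℝ (xiVF' a b) p (xiVF' a b p) = a ^ 2 • (((1 : ℝ), (0 : ℝ)) : ℝ × ℝ) := by
  rw [(hasFDerivAt_xiVF' a b p).fderiv]
  simp [xiVF', sq]

/-- For `ξ' = a·ξ + b·ζ` one has `∇_{ξ'}ξ' = a²·ζ` and
`ω(∇_{ξ'}ξ', ξ') = a³`; hence the normalization `ω(∇_{ξ'}ξ', ξ') = 1`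
forces `a = 1` and `∇_{ξ'}ξ' = ζ`.  (Here `(∇_X Y)(p) = (DY)(p)(X(p))` is the
standard flat connection and `ζ(x,y) = (1,0)`.) -/
theorem normalization_forces_a_eq_one (a b : ℝ) :
    (∀ p : ℝ × ℝ, fderiv ℝ (xiVF' a b) p (xiVF' a b p)
        = a ^ 2 • (((1 : ℝ), (0 : ℝ)) : ℝ × ℝ)) ∧
    (∀ p : ℝ × ℝ,
      areaForm (fderiv ℝ (xiVF' a b) p (xiVF' a b p)) (xiVF' a b p) = a ^ 3) ∧
    ((∀ p : ℝ × ℝ,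
        areaForm (fderiv ℝ (xiVF' a b) p (xiVF' a b p)) (xiVF' a b p) = 1) →
      a = 1 ∧ ∀ p : ℝ × ℝ,
        fderiv ℝ (xiVF' a b) p (xiVF' a b p) = (((1 : ℝ), (0 : ℝ)) : ℝ × ℝ)) := by
  have hnabla := fderiv_xiVF'_self a b
  have harea (p : ℝ × ℝ) :
      areaForm (fderiv ℝ (xiVF' a b) p (xiVF' a b p)) (xiVF' a b p) = a ^ 3 := by
    rw [hnabla]
    simp only [areaForm, xiVF', Prod.smul_mk, smul_eq_mul]
    ring
  refine ⟨hnabla, harea, fun h => ?_⟩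
  have ha : a = 1 := by
    have h3 : a ^ 3 = 1 := (harea 0).symm.trans (h 0)
    exact (Odd.strictMono_pow (by decide : Odd 3)).injective (h3.trans (one_pow 3).symm)
  exact ⟨ha, fun p => by rw [hnabla, ha, one_pow, one_smul]⟩
end

section
/- For every nonzero k = (k₁,k₂) ∈ ℝ², the map Ψ_k factors as Ψ_k = Q_k⁻¹ ∘ Φ_{‖k‖³} ∘ Q_k, where ‖k‖ = √(k₁² + k₂²), Q_k : ℝ² → ℝ² is the rotation Q_k(x,y) = ((k₂x − k₁y)/‖k‖, (k₁x + k₂y)/‖k‖), and Q_k⁻¹(u,v) = ((k₂u + k₁v)/‖k‖, (−k₁u + k₂v)/‖k‖). -/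
/-- The polynomial map `Ψ_k(x,y) = (x,y) + ½·(k₁x + k₂y)²·(k₂, −k₁)`. -/
noncomputable def Psi (k p : ℝ × ℝ) : ℝ × ℝ :=
  (p.1 + 1 / 2 * (k.1 * p.1 + k.2 * p.2) ^ 2 * k.2,
   p.2 - 1 / 2 * (k.1 * p.1 + k.2 * p.2) ^ 2 * k.1)

/-- The polynomial diffeomorphism `Φ_ε(x,y) = (x + ε·y²/2, y)`. -/
noncomputable def Phi (ε : ℝ) (p : ℝ × ℝ) : ℝ × ℝ := (p.1 + ε * p.2 ^ 2 / 2, p.2)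

/-- `‖k‖ = √(k₁² + k₂²)`. -/
noncomputable def knorm (k : ℝ × ℝ) : ℝ := Real.sqrt (k.1 ^ 2 + k.2 ^ 2)

/-- The rotation `Q_k(x,y) = ((k₂x − k₁y)/‖k‖, (k₁x + k₂y)/‖k‖)`. -/
noncomputable def Qrot (k p : ℝ × ℝ) : ℝ × ℝ :=
  ((k.2 * p.1 - k.1 * p.2) / knorm k, (k.1 * p.1 + k.2 * p.2) / knorm k)

/-- The inverse rotation `Q_k⁻¹(u,v) = ((k₂u + k₁v)/‖k‖, (−k₁u + k₂v)/‖k‖)`. -/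
noncomputable def QrotInv (k p : ℝ × ℝ) : ℝ × ℝ :=
  ((k.2 * p.1 + k.1 * p.2) / knorm k, (-k.1 * p.1 + k.2 * p.2) / knorm k)

/-- `‖k‖² = k₁² + k₂²`. -/
theorem knorm_sq (k : ℝ × ℝ) : knorm k ^ 2 = k.1 ^ 2 + k.2 ^ 2 :=
  Real.sq_sqrt (by positivity)

theorem knorm_ne_zero {k : ℝ × ℝ} (hk : k ≠ 0) : knorm k ≠ 0 := by
  contrapose! hk
  have h := knorm_sq k
  rw [hk] at h
  ext
  · exact pow_eq_zero_iff two_ne_zero |>.1 (by nlinarith [sq_nonneg k.1, sq_nonneg k.2])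
  · exact pow_eq_zero_iff two_ne_zero |>.1 (by nlinarith [sq_nonneg k.1, sq_nonneg k.2])

/-- For nonzero `k`, `Ψ_k` factors as `Q_k⁻¹ ∘ Φ_{‖k‖³} ∘ Q_k`. -/
theorem psi_eq_conj_phi (k : ℝ × ℝ) (hk : k ≠ 0) :
    ∀ p : ℝ × ℝ, Psi k p = QrotInv k (Phi (knorm k ^ 3) (Qrot k p)) := by
  intro p
  have hn := knorm_ne_zero hk
  have hsq := knorm_sq k
  ext
  · simp only [Psi, QrotInv, Phi, Qrot]
    field_simp
    linear_combination 2 * p.1 * hsq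
  · simp only [Psi, QrotInv, Phi, Qrot]
    field_simp
    linear_combination 2 * p.2 * hsq
end

section
/- For every k = (k₁,k₂) ∈ ℝ² and every v = (s,t) ∈ ℝ², the conjugated holonomy transformation h_k(v) := Ψ_k ∘ T_v ∘ Ψ_{−k} is the affine map given for every p ∈ ℝ² by h_k(v)(p) = p + v + (⟨k, v⟩·⟨k, p⟩ + ½·⟨k, v⟩²)·(k₂, −k₁), where ⟨·,·⟩ denotes the standard inner product on ℝ². In particular each h_k(v) is an affine transformation of the plane, and v ↦ h_k(v) is a homomorphism from (ℝ², +) to the group of affine transformations. -/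
/-- The conjugated holonomy transformation `h_k(v) = Ψ_k ∘ T_v ∘ Ψ_{−k}`,
where `T_v` is translation by `v`. -/
noncomputable def holk (k v p : ℝ × ℝ) : ℝ × ℝ := Psi k (Psi (-k) p + v)

/-- The standard inner product `⟨k, v⟩ = k₁v₁ + k₂v₂` on `ℝ²`. -/
noncomputable def inp (k v : ℝ × ℝ) : ℝ := k.1 * v.1 + k.2 * v.2

/-- The holonomy transformation `h_k(v)` written out as an affine map. -/
theorem holk_apply (k v p : ℝ × ℝ) :
    holk k v p =
      p + v + (inp k v * inp k p + 1 / 2 * inp k v ^ 2) • ((k.2, -k.1) : ℝ × ℝ) := by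
  ext <;>
    simp only [holk, Psi, inp, Prod.fst_add, Prod.snd_add, Prod.fst_neg, Prod.snd_neg,
      Prod.smul_fst, Prod.smul_snd, smul_eq_mul] <;>
    ring

/-- For every `k` and `v`, the conjugated holonomy transformation
`h_k(v) = Ψ_k ∘ T_v ∘ Ψ_{−k}` is the affine map
`p ↦ p + v + (⟨k,v⟩·⟨k,p⟩ + ½·⟨k,v⟩²)·(k₂, −k₁)`, and `v ↦ h_k(v)` is a
homomorphism from `(ℝ², +)` to the group of affine transformations of the
plane. -/
theorem holk_affine_formula (k : ℝ × ℝ) :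
    (∀ v p : ℝ × ℝ,
      holk k v p =
        p + v + (inp k v * inp k p + 1 / 2 * inp k v ^ 2) • ((k.2, -k.1) : ℝ × ℝ)) ∧
    holk k 0 = id ∧
    (∀ v w : ℝ × ℝ, holk k v ∘ holk k w = holk k (v + w)) := by
  refine ⟨holk_apply k, ?_, fun v w => ?_⟩
  · funext p
    simp [holk_apply, inp]
  · funext p
    ext <;>
      simp only [Function.comp_apply, holk_apply, inp, Prod.fst_add, Prod.snd_add,
        Prod.smul_fst, Prod.smul_snd, smul_eq_mul] <;>
      ring
end

section
/- For every k ∈ ℝ², the action of the additive group ℤ² on ℝ² defined by m • p := Ψ_k(Ψ_{−k}(p) + m) (where m ∈ ℤ² is regarded as an integer vector in ℝ²) is free and properly discontinuous: (i) if m • p = p for some p ∈ ℝ², then m = 0; and (ii) for all compact subsets K₁, K₂ ⊆ ℝ², the set { m ∈ ℤ² : (m • K₁) ∩ K₂ ≠ ∅ } is finite. -/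
/-- The action of `ℤ²` on `ℝ²`: `m • p = Ψ_k(Ψ_{−k}(p) + m)`, where the
integer vector `m` is regarded as a vector in `ℝ²`.  These are the affine
holonomy transformations of the complete affine torus with period class `k`. -/
noncomputable def holAct (k : ℝ × ℝ) (m : ℤ × ℤ) (p : ℝ × ℝ) : ℝ × ℝ :=
  Psi k (Psi (-k) p + ((m.1 : ℝ), (m.2 : ℝ)))

/-- `Psi (-k)` is a left inverse of `Psi k`. -/
theorem Psi_neg_Psi (k p : ℝ × ℝ) : Psi (-k) (Psi k p) = p := by
  ext <;> simp only [Psi, Prod.fst_neg, Prod.snd_neg] <;> ring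

theorem continuous_Psi (k : ℝ × ℝ) : Continuous (Psi k) := by
  unfold Psi
  fun_prop

/-- The translation vector is recovered from a point and its image under the action. -/
theorem intCast_eq_sub_of_holAct_eq {k p q : ℝ × ℝ} {m : ℤ × ℤ} (h : holAct k m p = q) :
    Prod.map ((↑) : ℤ → ℝ) ((↑) : ℤ → ℝ) m = Psi (-k) q - Psi (-k) p := by
  rw [← h, holAct, Psi_neg_Psi, add_sub_cancel_left]
  rfl

/-- For every `k`, the `ℤ²`-action `m • p = Ψ_k(Ψ_{−k}(p) + m)` is free and
properly discontinuous: (i) if `m • p = p` for some `p` then `m = 0`, and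
(ii) for all compact `K₁, K₂ ⊆ ℝ²` the set of `m` with `(m • K₁) ∩ K₂ ≠ ∅`
is finite. -/
theorem holAct_free_properly_discontinuous (k : ℝ × ℝ) :
    (∀ (m : ℤ × ℤ) (p : ℝ × ℝ), holAct k m p = p → m = 0) ∧
    (∀ K₁ K₂ : Set (ℝ × ℝ), IsCompact K₁ → IsCompact K₂ →
      {m : ℤ × ℤ | (holAct k m '' K₁ ∩ K₂).Nonempty}.Finite) := by
  have emb := Int.isClosedEmbedding_coe_real.prodMap Int.isClosedEmbedding_coe_real
  refine ⟨fun m p h => ?_, fun K₁ K₂ h₁ h₂ => ?_⟩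
  · apply emb.injective
    rw [intCast_eq_sub_of_holAct_eq h, sub_self]
    exact (Prod.ext Int.cast_zero Int.cast_zero : Prod.map _ _ (0 : ℤ × ℤ) = 0).symm
  · have hc : IsCompact ((fun x : (ℝ × ℝ) × (ℝ × ℝ) => Psi (-k) x.2 - Psi (-k) x.1) ''
        (K₁ ×ˢ K₂)) :=
      (h₁.prod h₂).image (((continuous_Psi _).comp continuous_snd).sub
        ((continuous_Psi _).comp continuous_fst))
    refine (emb.isCompact_preimage hc).finite_of_discrete.subset ?_
    rintro m ⟨q, ⟨p, hp, hpq⟩, hq⟩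
    exact ⟨(p, q), ⟨hp, hq⟩, (intCast_eq_sub_of_holAct_eq hpq).symm⟩
end

section
/- If f : ℝ → ℝ satisfies f(a)³ = −a for every a ∈ ℝ (i.e., f(a) is the real cube root of −a), then f is not differentiable at 0. Consequently, the curve a ↦ (0, f(a)) in ℝ², which is the period-class curve a ↦ p(𝓔_a) = (0, −a^{1/3}) of the differentiable family 𝓔 of complete affine tori with developing maps (x,y) ↦ (x, y + ½·a·x²), is continuous but not smooth at a = 0. -/
/-- A function `f` with `f a ^ 3 = -a` for all `a` is continuous: `-f` is monotone and surjective. -/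
theorem continuous_of_pow_three_eq_neg {f : ℝ → ℝ} (hf : ∀ a, f a ^ 3 = -a) : Continuous f := by
  have hcube : StrictMono fun x : ℝ => x ^ 3 := Odd.strictMono_pow (by decide)
  have hmono : Monotone fun a => -f a := fun a b hab =>
    neg_le_neg (hcube.le_iff_le.1 (by simpa only [hf] using neg_le_neg hab))
  have hsurj : Function.Surjective fun a => -f a := fun c =>
    ⟨c ^ 3, hcube.injective (by simp only [Odd.neg_pow (by decide : Odd 3), hf, neg_neg])⟩
  exact continuous_neg_iff.1 (hmono.continuous_of_surjective hsurj)

/-- A function `f` with `f a ^ 3 = -a` for all `a` is not differentiable at `0`: the chain rule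
would give derivative `0` at `0` to `a ↦ -a`. -/
theorem not_differentiableAt_of_pow_three_eq_neg {f : ℝ → ℝ} (hf : ∀ a, f a ^ 3 = -a) :
    ¬ DifferentiableAt ℝ f 0 := by
  intro hd
  have hf0 : f 0 = 0 := (pow_eq_zero_iff three_ne_zero).1 (by simpa using hf 0)
  have hcube : HasDerivAt (fun a => f a ^ 3) 0 0 := by
    simpa [hf0] using hd.hasDerivAt.fun_pow 3
  simp only [hf] at hcube
  exact absurd (hcube.unique (hasDerivAt_neg 0)) (by norm_num)

/-- If `f : ℝ → ℝ` satisfies `f(a)³ = −a` for all `a` (so `f(a)` is the real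
cube root of `−a`), then `f` is continuous but not differentiable at `0`;
consequently the period-class curve `a ↦ (0, f(a)) = (0, −a^{1/3})` of the
differentiable family `𝓔` of complete affine tori with developing maps
`(x,y) ↦ (x, y + ½·a·x²)` is continuous but not differentiable at `a = 0`. -/
theorem cube_root_curve_not_smooth (f : ℝ → ℝ) (hf : ∀ a : ℝ, f a ^ 3 = -a) :
    Continuous f ∧
    ¬ DifferentiableAt ℝ f 0 ∧
    Continuous (fun a : ℝ => ((0 : ℝ), f a)) ∧
    ¬ DifferentiableAt ℝ (fun a : ℝ => ((0 : ℝ), f a)) 0 := by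
  have hcont := continuous_of_pow_three_eq_neg hf
  have hdiff := not_differentiableAt_of_pow_three_eq_neg hf
  exact ⟨hcont, hdiff, continuous_const.prodMk hcont, fun h => hdiff h.snd⟩
end
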